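/- arXiv:1501.03791 — 9 statements merged into one kernel-verified Lean document; each statement's English description precedes it below -/
import Mathlib

section
/- Let V be a real vector space, f : V → EReal and g : Module.Dual ℝ V → EReal. Then ⨆ k : Module.Dual ℝ V, (f⋆ k - g k) = ⨆ x : V, (g⋆ x - f x), where f⋆ is the Legendre–Fenchel transform of f and g⋆ is the reverse Legendre–Fenchel transform of g. (In the language of the paper: the Legendre–Fenchel transform and its reverse form an EReal-enriched adjunction, d(f⋆, g) = d(f, g⋆).) -/
/-- The Legendre–Fenchel transform of `f : V → EReal`. -/
noncomputable def LFt {V : Type*} [AddCommGroup V] [Module ℝ V] (f : V → EReal) :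
    Module.Dual ℝ V → EReal := fun k => ⨆ x : V, ((k x : EReal) - f x)

/-- The reverse Legendre–Fenchel transform of `g : Module.Dual ℝ V → EReal`. -/
noncomputable def LFr {V : Type*} [AddCommGroup V] [Module ℝ V]
    (g : Module.Dual ℝ V → EReal) : V → EReal :=
  fun x => ⨆ k : Module.Dual ℝ V, ((k x : EReal) - g k)

/-- Adding a constant on the right commutes with arbitrary suprema in `EReal`, since `⊥` is
absorbing for addition. -/
theorem EReal.iSup_add_const {ι : Sort*} (u : ι → EReal) (c : EReal) :
    (⨆ i, u i) + c = ⨆ i, (u i + c) := by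
  apply le_antisymm
  · induction c with
    | bot => simp
    | coe r =>
      rw [← EReal.le_sub_iff_add_le (by simp) (by simp)]
      refine iSup_le fun i => ?_
      rw [EReal.le_sub_iff_add_le (by simp) (by simp)]
      exact le_iSup (fun i => u i + (r : EReal)) i
    | top =>
      by_cases h : ∀ i, u i = ⊥
      · simp [h]
      · push Not at h
        obtain ⟨i, hi⟩ := h
        exact (le_top.trans_eq (EReal.add_top_of_ne_bot hi).symm).trans
          (le_iSup (fun i => u i + ⊤) i)
  · exact iSup_le fun i => add_le_add_left (le_iSup u i) c

/-- The Legendre–Fenchel transform and its reverse form an `EReal`-enriched adjunction: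
`d(f⋆, g) = d(f, g⋆)`. -/
theorem LF_adjunction (V : Type*) [AddCommGroup V] [Module ℝ V]
    (f : V → EReal) (g : Module.Dual ℝ V → EReal) :
    (⨆ k : Module.Dual ℝ V, (LFt f k - g k)) = ⨆ x : V, (LFr g x - f x) := by
  simp only [LFt, LFr, sub_eq_add_neg, EReal.iSup_add_const]
  rw [iSup_comm]
  simp only [add_right_comm]
end

section
/- Let V be a real vector space and f₁, f₂ : V → EReal. Then ⨆ x : V, (f₂ x - f₁ x) ≥ ⨆ k : Module.Dual ℝ V, (f₁⋆ k - f₂⋆ k). (The Legendre–Fenchel transform is a distance non-increasing map for the asymmetric EReal-metrics d(f₁,f₂) = ⨆ₓ (f₂ x - f₁ x) on functions on V and d(g₁,g₂) = ⨆ₖ (g₁ k - g₂ k) on functions on the dual.) -/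
/-- A triangle inequality for `EReal` subtraction from a real number. -/
theorem EReal.coe_sub_le_sub_add_coe_sub {a b : EReal} (r : ℝ) (hb : b ≠ ⊥)
    (hab : b - a ≠ ⊤) : (r : EReal) - a ≤ (b - a) + (r - b) := by
  induction a with
  | top => simp
  | bot => exact absurd (EReal.sub_bot hb) hab
  | coe a =>
    induction b with
    | bot => exact absurd rfl hb
    | top => exact absurd (EReal.top_sub_coe a) hab
    | coe b =>
      norm_cast
      linarith

/-- The Legendre–Fenchel transform is distance non-increasing for the asymmetric
`EReal`-metrics on the function spaces. -/
theorem LF_short (V : Type*) [AddCommGroup V] [Module ℝ V] (f₁ f₂ : V → EReal) :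
    (⨆ x : V, (f₂ x - f₁ x)) ≥ ⨆ k : Module.Dual ℝ V, (LFt f₁ k - LFt f₂ k) := by
  refine iSup_le fun k => ?_
  by_cases hD : (⨆ x : V, (f₂ x - f₁ x)) = ⊤
  · rw [hD]
    exact le_top
  by_cases hk : LFt f₂ k = ⊤
  · rw [hk, EReal.sub_top]
    exact bot_le
  refine EReal.sub_le_of_le_add (iSup_le fun x => ?_)
  have hsub : f₂ x - f₁ x ≤ ⨆ y : V, (f₂ y - f₁ y) := le_iSup (fun y => f₂ y - f₁ y) x
  have hLF : (k x : EReal) - f₂ x ≤ LFt f₂ k := le_iSup (fun y => (k y : EReal) - f₂ y) x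
  have hbot : f₂ x ≠ ⊥ := by
    intro h
    rw [h, EReal.sub_bot (EReal.coe_ne_bot _)] at hLF
    exact hk (top_le_iff.mp hLF)
  exact (EReal.coe_sub_le_sub_add_coe_sub (k x) hbot (ne_top_of_le_ne_top hD hsub)).trans
    (add_le_add hsub hLF)
end

section
/- Let V be a real vector space, f : V → EReal and g : Module.Dual ℝ V → EReal. Then (∀ k : Module.Dual ℝ V, f⋆ k ≤ g k) if and only if (∀ x : V, g⋆ x ≤ f x). (The Legendre–Fenchel transform and its reverse form a Galois connection with respect to the pointwise domination orders.) -/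
theorem EReal.coe_sub_le_comm (r : ℝ) (a b : EReal) :
    (r : EReal) - a ≤ b ↔ (r : EReal) - b ≤ a := by
  induction a <;> induction b <;> simp [← EReal.coe_sub, add_comm]

/-- The Legendre–Fenchel transform and its reverse form a Galois connection with respect to
the pointwise domination orders. -/
theorem LF_galoisConnection (V : Type*) [AddCommGroup V] [Module ℝ V]
    (f : V → EReal) (g : Module.Dual ℝ V → EReal) :
    (∀ k : Module.Dual ℝ V, LFt f k ≤ g k) ↔ (∀ x : V, LFr g x ≤ f x) := by
  simp only [LFt, LFr, iSup_le_iff]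
  rw [forall_comm]
  exact forall₂_congr fun x k => EReal.coe_sub_le_comm (k x) (f x) (g k)
end

section
/- Let V be a real vector space and f : V → EReal. Then the triple Legendre–Fenchel transform equals the single transform: (f⋆⋆)⋆ = f⋆ as functions Module.Dual ℝ V → EReal. (Idempotency of the closure operator f ↦ f⋆⋆; equivalently, every conjugate function is closed.) -/
theorem EReal.coe_sub_le_comm_s4 {a : ℝ} {y z : EReal} (h : (a : EReal) - y ≤ z) :
    (a : EReal) - z ≤ y := by
  have hy : (a : EReal) - (a - y) = y := by
    induction y with
    | bot => simp
    | top => simp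
    | coe y => norm_cast; ring
  exact (EReal.sub_le_sub le_rfl h).trans_eq hy

/-- The triple Legendre–Fenchel transform equals the single transform. -/
theorem LF_triple_eq (V : Type*) [AddCommGroup V] [Module ℝ V] (f : V → EReal) :
    LFt (LFr (LFt f)) = LFt f := by
  funext k
  apply le_antisymm
  · exact iSup_le fun x => EReal.coe_sub_le_comm_s4
      (le_iSup (fun l : Module.Dual ℝ V => (l x : EReal) - LFt f l) k)
  · exact iSup_mono fun x => EReal.sub_le_sub le_rfl <| iSup_le fun l =>
      EReal.coe_sub_le_comm_s4 (le_iSup (fun y => (l y : EReal) - f y) x)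
end

section
/- Let V be a real vector space and f : V → EReal. Then for every x : V, the biconjugate f⋆⋆ x equals the supremum of the values at x of all affine minorants of f: f⋆⋆ x = sSup { t : EReal | ∃ (k : Module.Dual ℝ V) (c : ℝ), (∀ y : V, ((k y : EReal) - (c : EReal)) ≤ f y) ∧ t = (k x : EReal) - (c : EReal) }. (This is the algebraic form of the theorem that f⋆⋆ is the lower semicontinuous convex hull of f: its graph is the envelope of the supporting hyperplanes of f.) -/
/-- For real `a` and `c`, the terms `c` and `e` can be exchanged in `a - e ≤ c`. -/
theorem EReal.coe_sub_le_coe_iff (a c : ℝ) (e : EReal) :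
    (a : EReal) - e ≤ c ↔ (a : EReal) - c ≤ e := by
  induction e with
  | bot => simp [← EReal.coe_sub]
  | top => simp
  | coe r => norm_cast; exact sub_le_comm

/-- `a - e` is bounded by every common upper bound of the `a - c` with `c` real and `e ≤ c`. -/
theorem EReal.coe_sub_le_of_forall_coe {a : ℝ} {e S : EReal}
    (h : ∀ c : ℝ, e ≤ c → (a : EReal) - c ≤ S) : (a : EReal) - e ≤ S := by
  induction e with
  | bot =>
    have hS : S = ⊤ := by
      refine EReal.eq_top_iff_forall_lt S |>.2 fun r => ?_
      refine lt_of_lt_of_le ?_ (h (a - (r + 1)) bot_le)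
      norm_cast
      linarith
    simp [hS]
  | top => simp
  | coe r => exact h r le_rfl

/-- The conjugate at `k` is at most `c` exactly when `(k, c)` is an affine minorant. -/
theorem LFt_le_coe_iff {V : Type*} [AddCommGroup V] [Module ℝ V] (f : V → EReal)
    (k : Module.Dual ℝ V) (c : ℝ) :
    LFt f k ≤ c ↔ ∀ y : V, (k y : EReal) - (c : EReal) ≤ f y := by
  simp only [LFt, iSup_le_iff, EReal.coe_sub_le_coe_iff]

/-- The biconjugate equals the pointwise supremum of the affine minorants of `f`:
its graph is the envelope of the supporting hyperplanes of `f`. -/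
theorem LF_biconjugate_eq_sSup_affine_minorants
    (V : Type*) [AddCommGroup V] [Module ℝ V] (f : V → EReal) (x : V) :
    LFr (LFt f) x =
      sSup { t : EReal | ∃ (k : Module.Dual ℝ V) (c : ℝ),
        (∀ y : V, ((k y : EReal) - (c : EReal)) ≤ f y) ∧
        t = (k x : EReal) - (c : EReal) } := by
  apply le_antisymm
  · exact iSup_le fun k => EReal.coe_sub_le_of_forall_coe fun c hc =>
      le_sSup ⟨k, c, (LFt_le_coe_iff f k c).1 hc, rfl⟩
  · refine sSup_le ?_
    rintro t ⟨k, c, h, rfl⟩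
    exact (EReal.sub_le_sub le_rfl ((LFt_le_coe_iff f k c).2 h)).trans
      (le_iSup (fun k : Module.Dual ℝ V => (k x : EReal) - LFt f k) k)
end

section
/- Toland–Singer duality: let V be a real vector space and f₁, f₂ : V → EReal with f₂ closed (f₂ = f₂⋆⋆). Then ⨆ x : V, (f₂ x - f₁ x) = ⨆ k : Module.Dual ℝ V, (f₁⋆ k - f₂⋆ k). (The Legendre–Fenchel transform preserves the asymmetric EReal-distance d(f₁,f₂) = ⨆ₓ (f₂ x - f₁ x) when the second argument is closed; in particular it is a distance-preserving bijection on closed functions.) -/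
/-- Addition in `EReal` distributes over arbitrary suprema, since `⊥` is absorbing. -/
theorem EReal.iSup_add_eq {ι : Sort*} (u : ι → EReal) (a : EReal) :
    (⨆ i, u i) + a = ⨆ i, (u i + a) := by
  refine le_antisymm (EReal.add_le_of_forall_lt fun b hb c hc => ?_)
    (iSup_le fun i => add_le_add_left (le_iSup u i) a)
  obtain ⟨i, hi⟩ := lt_iSup_iff.mp hb
  exact (add_le_add hi.le hc.le).trans (le_iSup (fun i => u i + a) i)

/-- Toland–Singer duality: the Legendre–Fenchel transform preserves the asymmetric
`EReal`-distance when the second argument is closed. -/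
theorem tolandSinger (V : Type*) [AddCommGroup V] [Module ℝ V]
    (f₁ f₂ : V → EReal) (hf₂ : f₂ = LFr (LFt f₂)) :
    (⨆ x : V, (f₂ x - f₁ x)) = ⨆ k : Module.Dual ℝ V, (LFt f₁ k - LFt f₂ k) := by
  have hl : ∀ x, f₂ x - f₁ x =
      ⨆ k : Module.Dual ℝ V, ((k x : EReal) + -LFt f₂ k + -f₁ x) := fun x => by
    rw [← EReal.iSup_add_eq, congrFun hf₂ x]
    rfl
  have hr : ∀ k, LFt f₁ k - LFt f₂ k = ⨆ x : V, ((k x : EReal) + -f₁ x + -LFt f₂ k) := fun k => by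
    rw [← EReal.iSup_add_eq]
    rfl
  simp_rw [hl, hr, add_right_comm _ (-LFt f₂ _)]
  exact iSup_comm
end

section
/- Let V be a real vector space, ι an index type, and f : ι → (V → EReal) a family of closed functions (f i = (f i)⋆⋆ for every i). Then the pointwise supremum g := fun x => ⨆ i, f i x is closed: g = g⋆⋆. (This is the formula for products in the nucleus: the product of lower semicontinuous convex functions is their pointwise supremum.) -/
theorem EReal.coe_sub_coe_sub_self (a : ℝ) (b : EReal) : (a : EReal) - (a - b) = b := by
  induction b with
  | bot => simp
  | top => simp
  | coe b => norm_cast; ring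

section LegendreFenchel

variable {V : Type*} [AddCommGroup V] [Module ℝ V]

theorem LFt_antitone : Antitone (LFt (V := V)) :=
  fun _ _ h _ => iSup_mono fun x => EReal.sub_le_sub le_rfl (h x)

theorem LFr_antitone : Antitone (LFr (V := V)) :=
  fun _ _ h _ => iSup_mono fun k => EReal.sub_le_sub le_rfl (h k)

theorem LFr_LFt_le (f : V → EReal) : LFr (LFt f) ≤ f := fun x => iSup_le fun k =>
  calc (k x : EReal) - LFt f k ≤ k x - (k x - f x) :=
        EReal.sub_le_sub le_rfl (le_iSup (fun y : V => (k y : EReal) - f y) x)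
    _ = f x := EReal.coe_sub_coe_sub_self _ _

end LegendreFenchel

/-- The pointwise supremum of a family of closed functions is closed: products in the
nucleus are pointwise suprema. -/
theorem LF_iSup_closed (V : Type*) [AddCommGroup V] [Module ℝ V]
    (ι : Type*) (f : ι → (V → EReal)) (hf : ∀ i : ι, f i = LFr (LFt (f i))) :
    (fun x : V => ⨆ i : ι, f i x) = LFr (LFt (fun x : V => ⨆ i : ι, f i x)) := by
  refine le_antisymm (fun x => iSup_le fun i => ?_) (LFr_LFt_le _)
  rw [hf i]
  exact LFr_antitone (LFt_antitone fun y => le_iSup (fun j => f j y) i) x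
end

section
/- Let V be a real vector space, ι an index type, and f : ι → (V → EReal) a family of closed functions (f i = (f i)⋆⋆ for every i). Let h := (fun x => ⨅ i, f i x)⋆⋆ be the biconjugate of the pointwise infimum. Then (a) h ≤ f j pointwise for every j : ι, and (b) for every closed g : V → EReal with g ≤ f i pointwise for all i, one has g ≤ h pointwise. (This is the formula for coproducts in the nucleus: the coproduct of closed functions is the closed hull of their pointwise infimum, and it is their greatest closed lower bound.) -/
theorem LFt_antitone_s9 {V : Type*} [AddCommGroup V] [Module ℝ V] :
    Antitone (LFt : (V → EReal) → Module.Dual ℝ V → EReal) :=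
  fun _ _ h _ => iSup_mono fun x => EReal.sub_le_sub le_rfl (h x)

theorem LFr_antitone_s9 {V : Type*} [AddCommGroup V] [Module ℝ V] :
    Antitone (LFr : (Module.Dual ℝ V → EReal) → V → EReal) :=
  fun _ _ h _ => iSup_mono fun k => EReal.sub_le_sub le_rfl (h k)

/-- The coproduct of closed functions is the closed hull of their pointwise infimum, and it
is their greatest closed lower bound. -/
theorem LF_coproduct (V : Type*) [AddCommGroup V] [Module ℝ V]
    (ι : Type*) (f : ι → (V → EReal)) (hf : ∀ i : ι, f i = LFr (LFt (f i))) :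
    (∀ j : ι, ∀ x : V, LFr (LFt (fun x : V => ⨅ i : ι, f i x)) x ≤ f j x) ∧
    (∀ g : V → EReal, g = LFr (LFt g) → (∀ i : ι, ∀ x : V, g x ≤ f i x) →
      ∀ x : V, g x ≤ LFr (LFt (fun x : V => ⨅ i : ι, f i x)) x) := by
  refine ⟨fun j x => ?_, fun g hg hgf x => ?_⟩
  · rw [hf j]
    exact LFr_antitone_s9 (LFt_antitone_s9 fun y => iInf_le (fun i => f i y) j) x
  · rw [hg]
    exact LFr_antitone_s9 (LFt_antitone_s9 fun y => le_iInf fun i => hgf i y) x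
end

section
/- Let V be a real vector space and f : V → EReal. Then the epigraph of the Legendre–Fenchel transform f⋆ is a convex subset of Module.Dual ℝ V × ℝ: the set { p : Module.Dual ℝ V × ℝ | f⋆ p.1 ≤ (p.2 : EReal) } is convex over ℝ. (The conjugate of any function is convex.) -/
/-- The conjugate of any function is convex: its epigraph is a convex set. -/
theorem LF_conjugate_convex (V : Type*) [AddCommGroup V] [Module ℝ V]
    (f : V → EReal) :
    Convex ℝ { p : Module.Dual ℝ V × ℝ | LFt f p.1 ≤ (p.2 : EReal) } := by
  intro p hp q hq a b ha hb hab
  simp only [LFt, Set.mem_ofPred_eq, iSup_le_iff] at hp hq ⊢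
  intro x
  specialize hp x
  specialize hq x
  induction h : f x with
  | bot => simp [h] at hp
  | top => simp
  | coe c =>
    rw [h] at hp hq
    norm_cast at hp hq ⊢
    simp only [Prod.fst_add, Prod.smul_fst, Prod.snd_add, Prod.smul_snd, LinearMap.add_apply,
      LinearMap.smul_apply, smul_eq_mul]
    calc a * p.1 x + b * q.1 x - c = a * (p.1 x - c) + b * (q.1 x - c) := by
          linear_combination c * hab
      _ ≤ a * p.2 + b * q.2 := by gcongr
end
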